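/- arXiv:1810.00318 — 3 statements merged into one kernel-verified Lean document; each statement's English description precedes it below -/
import Mathlib

section
/- (Finsler's Lemma.) Let n, m be positive integers, let P ∈ ℝ^{n×n} be symmetric, and let H ∈ ℝ^{m×n} have rank r < n. Then the following two statements are equivalent: (i) for every ξ ∈ ℝ^n with ξ ≠ 0 and Hξ = 0 one has ξᵀPξ < 0; (ii) there exists X ∈ ℝ^{n×m} such that P + XH + HᵀXᵀ is negative definite. -/
open Matrix

lemma finsler_quad {n m : ℕ} (P : Matrix (Fin n) (Fin n) ℝ)
    (H : Matrix (Fin m) (Fin n) ℝ) (X : Matrix (Fin n) (Fin m) ℝ) (x : Fin n → ℝ) :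
    x ⬝ᵥ (P + X * H + Hᵀ * Xᵀ).mulVec x
      = x ⬝ᵥ P.mulVec x + 2 * (x ⬝ᵥ X.mulVec (H.mulVec x)) := by
  have h : x ⬝ᵥ (Hᵀ.mulVec (Xᵀ.mulVec x)) = x ⬝ᵥ X.mulVec (H.mulVec x) := by
    rw [dotProduct_mulVec, vecMul_transpose, dotProduct_mulVec x X, mulVec_transpose,
      dotProduct_comm]
  rw [add_mulVec, add_mulVec, dotProduct_add, dotProduct_add, ← mulVec_mulVec, ← mulVec_mulVec, h]
  ring

/-- Finsler's Lemma. -/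
theorem finsler_lemma (n m : ℕ) (hn : 0 < n) (hm : 0 < m)
    (P : Matrix (Fin n) (Fin n) ℝ) (hP : P.IsSymm)
    (H : Matrix (Fin m) (Fin n) ℝ) (hrank : H.rank < n) :
    (∀ ξ : Fin n → ℝ, ξ ≠ 0 → H.mulVec ξ = 0 → ξ ⬝ᵥ P.mulVec ξ < 0) ↔
      (∃ X : Matrix (Fin n) (Fin m) ℝ,
        ∀ x : Fin n → ℝ, x ≠ 0 → x ⬝ᵥ (P + X * H + Hᵀ * Xᵀ).mulVec x < 0) := by
  constructor
  · intro h
    have hnn : ∀ x : Fin n → ℝ, 0 ≤ H.mulVec x ⬝ᵥ H.mulVec x := fun x =>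
      Finset.sum_nonneg fun i _ => mul_self_nonneg _
    have cq : Continuous fun x : Fin n → ℝ => x ⬝ᵥ P.mulVec x := by fun_prop
    have ch : Continuous fun x : Fin n → ℝ => H.mulVec x ⬝ᵥ H.mulVec x := by fun_prop
    have hK : IsCompact (Metric.sphere (0 : Fin n → ℝ) 1 ∩ {x | 0 ≤ x ⬝ᵥ P.mulVec x}) :=
      (isCompact_sphere _ _).inter_right (isClosed_le continuous_const cq)
    have hpos : ∀ x ∈ Metric.sphere (0 : Fin n → ℝ) 1 ∩ {x | 0 ≤ x ⬝ᵥ P.mulVec x},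
        0 < H.mulVec x ⬝ᵥ H.mulVec x := by
      rintro x ⟨hx, hx2⟩
      refine lt_of_le_of_ne (hnn x) fun h0 => ?_
      have hx0 : x ≠ 0 := by
        rintro rfl
        simp at hx
      exact absurd (h x hx0 (dotProduct_self_eq_zero.1 h0.symm)) (not_lt.2 hx2)
    obtain ⟨C, hC⟩ := hK.bddAbove_image
      (cq.continuousOn.div ch.continuousOn fun x hx => (hpos x hx).ne')
    have key : ∀ x : Fin n → ℝ, ‖x‖ = 1 →
        x ⬝ᵥ P.mulVec x - 2 * ((|C| + 1) * (H.mulVec x ⬝ᵥ H.mulVec x)) < 0 := by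
      intro x hx
      by_cases hq : 0 ≤ x ⬝ᵥ P.mulVec x
      · have hm : x ∈ Metric.sphere (0 : Fin n → ℝ) 1 ∩ {x | 0 ≤ x ⬝ᵥ P.mulVec x} :=
          ⟨by simpa using hx, hq⟩
        have h1 := hC (Set.mem_image_of_mem _ hm)
        have h2 := hpos x hm
        have h3 := (div_le_iff₀ h2).1 h1
        nlinarith [le_abs_self C, abs_nonneg C, mul_nonneg (abs_nonneg C) h2.le,
          mul_le_mul_of_nonneg_right (le_abs_self C) h2.le]
      · nlinarith [mul_nonneg (abs_nonneg C) (hnn x), hnn x]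
    refine ⟨-((|C| + 1) • Hᵀ), fun x hx => ?_⟩
    have hxn : 0 < ‖x‖ := norm_pos_iff.2 hx
    have hk := key (‖x‖⁻¹ • x) (by rw [norm_smul, norm_inv, norm_norm, inv_mul_cancel₀ hxn.ne'])
    have e : x ⬝ᵥ Hᵀ.mulVec (H.mulVec x) = H.mulVec x ⬝ᵥ H.mulVec x := by
      rw [dotProduct_mulVec, vecMul_transpose]
    rw [finsler_quad, neg_mulVec, smul_mulVec, dotProduct_neg, dotProduct_smul, e]
    simp only [mulVec_smul, dotProduct_smul, smul_dotProduct, smul_eq_mul] at hk ⊢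
    have hi : 0 < ‖x‖⁻¹ * ‖x‖⁻¹ := by positivity
    by_contra hcon
    have := mul_nonneg hi.le (not_lt.1 hcon)
    nlinarith
  · rintro ⟨X, hX⟩ ξ h0 h1
    have := hX ξ h0
    rw [finsler_quad, h1] at this
    simpa using this
end

section
/- Let λ ∈ ℝ with λ ≠ 0, let P₁, P₂ ∈ ℝ^{n×n} be symmetric, and let M, X ∈ ℝ^{n×n}. Suppose the 2n×2n symmetric block matrix whose (1,1) block is −P₁ + He(XM), whose (2,1) block is −Xᵀ + λXM, whose (1,2) block is the transpose of the (2,1) block, and whose (2,2) block is P₂ − λ He(X), is negative definite. Then MᵀP₂M − P₁ is negative definite; in particular, (Mε)ᵀ P₂ (Mε) < εᵀ P₁ ε for every nonzero ε ∈ ℝ^n. -/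
open Matrix

theorem lmi_implies_lyapunov_decrease (n : ℕ) (l : ℝ) (hl : l ≠ 0)
    (P₁ P₂ M X : Matrix (Fin n) (Fin n) ℝ) (hP₁ : P₁.IsSymm) (hP₂ : P₂.IsSymm)
    (hblk : ∀ x : Fin n ⊕ Fin n → ℝ, x ≠ 0 →
      x ⬝ᵥ (fromBlocks
        (-P₁ + ((X * M) + (X * M)ᵀ))
        (-Xᵀ + l • (X * M))ᵀ
        (-Xᵀ + l • (X * M))
        (P₂ - l • (X + Xᵀ))).mulVec x < 0) :
    (∀ x : Fin n → ℝ, x ≠ 0 → x ⬝ᵥ (Mᵀ * P₂ * M - P₁).mulVec x < 0) ∧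
      ∀ ε : Fin n → ℝ, ε ≠ 0 →
        M.mulVec ε ⬝ᵥ P₂.mulVec (M.mulVec ε) < ε ⬝ᵥ P₁.mulVec ε := by
  have key : ∀ ε : Fin n → ℝ, ε ≠ 0 →
        M.mulVec ε ⬝ᵥ P₂.mulVec (M.mulVec ε) < ε ⬝ᵥ P₁.mulVec ε := by
    intro ε hε
    have hne : Sum.elim ε (M.mulVec ε) ≠ 0 := by
      intro h
      apply hε
      funext i
      exact congrFun h (Sum.inl i)
    have h := hblk _ hne
    have ht : ∀ (A : Matrix (Fin n) (Fin n) ℝ) (u v : Fin n → ℝ),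
        u ⬝ᵥ Aᵀ.mulVec v = v ⬝ᵥ A.mulVec u := by
      intro A u v
      rw [mulVec_transpose, dotProduct_comm, dotProduct_mulVec]
    rw [fromBlocks_mulVec] at h
    simp only [Sum.elim_comp_inl, Sum.elim_comp_inr, sumElim_dotProduct_sumElim,
      add_mulVec, sub_mulVec, neg_mulVec, smul_mulVec, dotProduct_add, dotProduct_sub,
      dotProduct_neg, dotProduct_smul, ht, ← mulVec_mulVec, smul_eq_mul] at h
    linarith
  refine ⟨fun x hx => ?_, key⟩
  have h := key x hx
  rw [sub_mulVec, dotProduct_sub, ← mulVec_mulVec, ← mulVec_mulVec, mulVec_transpose,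
    dotProduct_comm, ← dotProduct_mulVec, dotProduct_comm]
  linarith
end

section
/- (Switched quadratic Lyapunov convergence.) Let S be a finite nonempty set, let M : S → ℝ^{n×n}, let P : S → ℝ^{n×n} assign to each s ∈ S a symmetric positive definite matrix, and let R ⊆ S × S be a set of allowed transitions such that for every (s,s') ∈ R the matrix M(s)ᵀ P(s') M(s) − P(s) is negative definite. Let (s_h)_{h∈ℕ} be any sequence in S with (s_h, s_{h+1}) ∈ R for all h, and define x_{h+1} = M(s_h) x_h from any x_0 ∈ ℝ^n. Then x_h → 0 as h → ∞. -/
open Matrix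

lemma coercive_aux (n : ℕ) (A : Matrix (Fin n) (Fin n) ℝ)
    (hA : ∀ x : Fin n → ℝ, x ≠ 0 → x ⬝ᵥ A.mulVec x < 0) :
    ∃ c : ℝ, 0 < c ∧ ∀ x : Fin n → ℝ, x ⬝ᵥ A.mulVec x ≤ -(c * ‖x‖ ^ 2) := by
  have hcont : Continuous fun x : Fin n → ℝ => x ⬝ᵥ A.mulVec x := by fun_prop
  rcases (Metric.sphere (0 : Fin n → ℝ) 1).eq_empty_or_nonempty with he | hne
  · refine ⟨1, one_pos, fun x => ?_⟩
    by_cases hx : x = 0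
    · simp [hx]
    · exfalso
      have : (‖x‖⁻¹ • x) ∈ Metric.sphere (0 : Fin n → ℝ) 1 := by
        simp [norm_smul, hx]
      rw [he] at this
      exact this
  · obtain ⟨y, hy, hmax⟩ := (isCompact_sphere (0 : Fin n → ℝ) 1).exists_isMaxOn hne
      hcont.continuousOn
    have hy0 : y ≠ 0 := by
      rintro rfl
      simp at hy
    refine ⟨-(y ⬝ᵥ A.mulVec y), by linarith [hA y hy0], fun x => ?_⟩
    by_cases hx : x = 0
    · simp [hx]
    · have hmem : (‖x‖⁻¹ • x) ∈ Metric.sphere (0 : Fin n → ℝ) 1 := by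
        simp [norm_smul, hx]
      have h1 := hmax hmem
      simp only [Set.mem_setOf_eq, mulVec_smul, smul_dotProduct, dotProduct_smul,
        smul_eq_mul] at h1
      have hpos : 0 < ‖x‖ := norm_pos_iff.mpr hx
      have h2 := mul_le_mul_of_nonneg_left h1 (sq_nonneg ‖x‖)
      have h3 : ‖x‖ ^ 2 * (‖x‖⁻¹ * (‖x‖⁻¹ * (x ⬝ᵥ A.mulVec x))) = x ⬝ᵥ A.mulVec x := by
        field_simp
      rw [h3] at h2
      linarith

/-- Switched quadratic Lyapunov convergence. -/
theorem switched_lyapunov_convergence (n : ℕ) (S : Type) [Fintype S] [Nonempty S]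
    (M P : S → Matrix (Fin n) (Fin n) ℝ) (hP : ∀ s, (P s).PosDef)
    (R : Set (S × S))
    (hR : ∀ p ∈ R, ∀ x : Fin n → ℝ, x ≠ 0 →
      x ⬝ᵥ ((M p.1)ᵀ * P p.2 * M p.1 - P p.1).mulVec x < 0)
    (s : ℕ → S) (hs : ∀ h : ℕ, (s h, s (h + 1)) ∈ R)
    (x : ℕ → Fin n → ℝ) (hx : ∀ h : ℕ, x (h + 1) = (M (s h)).mulVec (x h)) :
    Filter.Tendsto x Filter.atTop (nhds 0) := by
  have h1 : ∀ p : S × S, ∃ c : ℝ, 0 < c ∧ (p ∈ R → ∀ x : Fin n → ℝ,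
      x ⬝ᵥ ((M p.1)ᵀ * P p.2 * M p.1 - P p.1).mulVec x ≤ -(c * ‖x‖ ^ 2)) := by
    intro p
    by_cases hp : p ∈ R
    · obtain ⟨c, hc, h⟩ := coercive_aux n _ (hR p hp)
      exact ⟨c, hc, fun _ => h⟩
    · exact ⟨1, one_pos, fun h => absurd h hp⟩
  choose c hc hcR using h1
  obtain ⟨p0, hp0⟩ := Finite.exists_min c
  set V : ℕ → ℝ := fun h => x h ⬝ᵥ (P (s h)).mulVec (x h) with hV
  have hVnn : ∀ h, 0 ≤ V h := fun h => by
    simpa using (hP (s h)).posSemidef.dotProduct_mulVec_nonneg (x h)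
  have hstep : ∀ h, V (h + 1) + c p0 * ‖x h‖ ^ 2 ≤ V h := by
    intro h
    have h2 := hcR _ (hs h) (x h)
    have h3 : V (h + 1) = x h ⬝ᵥ ((M (s h))ᵀ * P (s (h + 1)) * M (s h)).mulVec (x h) := by
      simp only [hV]
      rw [hx h, ← mulVec_mulVec, ← mulVec_mulVec, dotProduct_mulVec (x h), vecMul_transpose]
    simp only [sub_mulVec, dotProduct_sub] at h2
    rw [← h3] at h2
    have h4 := mul_le_mul_of_nonneg_right (hp0 (s h, s (h + 1))) (sq_nonneg ‖x h‖)
    simp only [hV] at *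
    linarith
  have hsum : ∀ N, ∑ h ∈ Finset.range N, c p0 * ‖x h‖ ^ 2 ≤ V 0 - V N := by
    intro N
    induction N with
    | zero => simp
    | succ k ih =>
      rw [Finset.sum_range_succ]
      linarith [hstep k]
  have hsm : Summable fun h => c p0 * ‖x h‖ ^ 2 :=
    summable_of_sum_range_le (c := V 0)
      (fun h => mul_nonneg (hc p0).le (sq_nonneg _))
      (fun N => by linarith [hsum N, hVnn N])
  have ht := (hsm.tendsto_atTop_zero.const_mul (c p0)⁻¹).sqrt
  rw [tendsto_zero_iff_norm_tendsto_zero]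
  refine Filter.Tendsto.congr (fun h => ?_) (by simpa using ht)
  simp [(hc p0).ne']
end
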